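/- Let β ∈ (0,1), let h(x) = 2^{1−β} (Γ(β)/Γ(β/2)²) ∫_{−1}^x (1−y²)^{β/2−1} dy on [−1,1], and set v(x) = 1 − h(x). Then v(−1) = 1, v(1) = 0, and for every x ∈ (−1,1), (D^β_{−1+*} v)(x) + (D^β_{1−*} v)(x) = 0. -/

import Mathlib

open MeasureTheory Real Set Filter Topology

/-- The classical left-sided Caputo fractional derivative of order `β` with terminal `a`:
`(D^β_{a+*} h)(x) = (1/Γ(1−β)) ∫_a^x (x−t)^{−β} h′(t) dt`. -/
noncomputable def caputoL (β a : ℝ) (h : ℝ → ℝ) (x : ℝ) : ℝ :=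
  (1 / Real.Gamma (1 - β)) * ∫ t in Set.Ioc a x, (x - t) ^ (-β) * deriv h t

/-- The classical right-sided Caputo fractional derivative of order `β` with terminal `b`:
`(D^β_{b−*} h)(x) = −(1/Γ(1−β)) ∫_x^b (t−x)^{−β} h′(t) dt`. -/
noncomputable def caputoR (β b : ℝ) (h : ℝ → ℝ) (x : ℝ) : ℝ :=
  -((1 / Real.Gamma (1 - β)) * ∫ t in Set.Ico x b, (t - x) ^ (-β) * deriv h t)

/-- The Beta integral `B(a, a)` transported to the symmetric interval `[-1, 1]`. -/
theorem integral_one_sub_sq_rpow {a : ℝ} (ha : 0 < a) :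
    ∫ y in (-1 : ℝ)..1, (1 - y ^ 2) ^ (a - 1) =
      2 * (4 : ℝ) ^ (a - 1) * (Real.Gamma a ^ 2 / Real.Gamma (2 * a)) := by
  have hbeta : ∫ u in (0 : ℝ)..1, (u * (1 - u)) ^ (a - 1) =
      Real.Gamma a ^ 2 / Real.Gamma (2 * a) := by
    have hB := ProbabilityTheory.beta_eq_betaIntegralReal a a ha ha
    have hc : Complex.betaIntegral a a =
        ((∫ u in (0 : ℝ)..1, (u * (1 - u)) ^ (a - 1) : ℝ) : ℂ) := by
      rw [Complex.betaIntegral, ← intervalIntegral.integral_ofReal]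
      refine intervalIntegral.integral_congr fun u hu => ?_
      rw [uIcc_of_le zero_le_one] at hu
      have h1 : 0 ≤ 1 - u := sub_nonneg.2 hu.2
      simp only [Real.mul_rpow hu.1 h1]
      push_cast [Complex.ofReal_cpow hu.1, Complex.ofReal_cpow h1]
      rfl
    rw [hc, Complex.ofReal_re, ProbabilityTheory.beta] at hB
    rw [← hB, sq, two_mul]
  have hsub := intervalIntegral.integral_comp_mul_sub (a := 0) (b := 1)
    (fun y : ℝ => (1 - y ^ 2) ^ (a - 1)) (two_ne_zero' ℝ) 1
  have hcongr : ∫ u in (0 : ℝ)..1, (1 - (2 * u - 1) ^ 2) ^ (a - 1) =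
      ∫ u in (0 : ℝ)..1, (4 : ℝ) ^ (a - 1) * (u * (1 - u)) ^ (a - 1) := by
    refine intervalIntegral.integral_congr fun u hu => ?_
    rw [uIcc_of_le zero_le_one] at hu
    have h1 : 0 ≤ u * (1 - u) := mul_nonneg hu.1 (sub_nonneg.2 hu.2)
    rw [← Real.mul_rpow (by norm_num) h1]
    ring_nf
  rw [hcongr, intervalIntegral.integral_const_mul, hbeta] at hsub
  norm_num at hsub
  linarith

/-- For the exponent `β = 2 a`, the left fractional integral of `(1 - t ^ 2) ^ (a - 1)` depends
on `x` only through `1 - x ^ 2`. -/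
theorem integral_caputo_kernel_eq {a x : ℝ} (hx : x ∈ Ioo (-1 : ℝ) 1) :
    ∫ t in Ioo (-1) x, (x - t) ^ (-(2 * a)) * (1 - t ^ 2) ^ (a - 1) =
      2 * (4 : ℝ) ^ (a - 1) * (1 - x ^ 2) ^ (-a) * ∫ w in Ioi (0 : ℝ), (w * (1 + w)) ^ (a - 1) := by
  obtain ⟨hx1, hx2⟩ := hx
  have hD : ∀ w ∈ Ioi (0 : ℝ), 0 < 1 - x + 2 * w := fun w hw => by
    have := mem_Ioi.1 hw; linarith
  have hP : 0 < 1 - x ^ 2 := by nlinarith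
  let f : ℝ → ℝ := fun w => (2 * x * w - (1 - x)) / (1 - x + 2 * w)
  have himage : f '' Ioi 0 = Ioo (-1) x := by
    ext t
    constructor
    · rintro ⟨w, hw, rfl⟩
      have hDw := hD w hw
      have hw' := mem_Ioi.1 hw
      refine ⟨(lt_div_iff₀ hDw).2 ?_, (div_lt_iff₀ hDw).2 ?_⟩ <;> nlinarith
    · rintro ⟨ht1, ht2⟩
      have hxt : 0 < x - t := sub_pos.2 ht2
      refine ⟨(1 - x) * (1 + t) / (2 * (x - t)), ?_, ?_⟩
      · rw [mem_Ioi]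
        exact div_pos (mul_pos (by linarith) (by linarith)) (by linarith)
      · have hden : 1 - x + 2 * ((1 - x) * (1 + t) / (2 * (x - t))) =
            (1 - x) * (1 + x) / (x - t) := by
          field_simp
          ring
        simp only [f]
        rw [hden, div_eq_iff (div_pos (mul_pos (by linarith) (by linarith)) hxt).ne']
        field_simp
        ring
  have hderiv : ∀ w ∈ Ioi (0 : ℝ),
      HasDerivWithinAt f (2 * (1 - x ^ 2) / (1 - x + 2 * w) ^ 2) (Ioi 0) w := fun w hw => by
    have hn : HasDerivAt (fun w : ℝ => 2 * x * w - (1 - x)) (2 * x) w := by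
      simpa using ((hasDerivAt_id w).const_mul (2 * x)).sub_const (1 - x)
    have hd : HasDerivAt (fun w : ℝ => 1 - x + 2 * w) 2 w := by
      simpa using ((hasDerivAt_id w).const_mul 2).const_add (1 - x)
    have := hn.div hd (hD w hw).ne'
    refine (this.congr_deriv ?_).hasDerivWithinAt
    congr 1
    ring
  have hinj : InjOn f (Ioi 0) := fun u hu w hw huw => by
    simp only [f] at huw
    rw [div_eq_div_iff (hD u hu).ne' (hD w hw).ne'] at huw
    have : (2 * (1 - x ^ 2)) * (u - w) = 0 := by linarith
    rcases mul_eq_zero.1 this with h | h <;> linarith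
  rw [← himage, integral_image_eq_integral_abs_deriv_smul measurableSet_Ioi hderiv hinj,
    ← integral_const_mul]
  refine setIntegral_congr_fun measurableSet_Ioi fun w hw => ?_
  have hDw := hD w hw
  have hw' := mem_Ioi.1 hw
  have e1 : x - f w = (1 - x ^ 2) / (1 - x + 2 * w) := by
    simp only [f]
    field_simp
    ring
  have e2 : 1 - f w ^ 2 = 4 * (w * (1 + w)) * (1 - x ^ 2) / (1 - x + 2 * w) ^ 2 := by
    simp only [f]
    field_simp
    ring
  simp only [smul_eq_mul]
  rw [e1, e2, abs_of_pos (by positivity)]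
  generalize 1 - x + 2 * w = D at hDw
  generalize 1 - x ^ 2 = P at hP
  have hq : 0 < w * (1 + w) := by positivity
  generalize w * (1 + w) = q at hq
  have hD2 : (D ^ 2) ^ (a - 1) = D ^ (2 * a) * (D ^ 2)⁻¹ := by
    rw [← Real.rpow_natCast D 2, ← Real.rpow_mul hDw.le, ← Real.rpow_neg hDw.le,
      ← Real.rpow_add hDw]
    congr 1
    push_cast
    ring
  have hP2 : P ^ (-(2 * a)) * P ^ (a - 1) = P ^ (-a) * P⁻¹ := by
    rw [← Real.rpow_neg_one, ← Real.rpow_add hP, ← Real.rpow_add hP]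
    congr 1
    ring
  rw [Real.div_rpow hP.le hDw.le, Real.div_rpow (by positivity) (by positivity),
    Real.mul_rpow (by positivity) hP.le, Real.mul_rpow (by norm_num) hq.le, hD2,
    Real.rpow_neg hDw.le]
  have hDa : 0 < D ^ (2 * a) := Real.rpow_pos_of_pos hDw _
  calc _ = 2 * P * (4 ^ (a - 1) * q ^ (a - 1)) * (P ^ (-(2 * a)) * P ^ (a - 1)) := by
        field_simp
    _ = _ := by
        rw [hP2]
        field_simp

/-- The left and right fractional integrals of `(1 - t ^ 2) ^ (a - 1)` of exponent `2 a` agree. -/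
theorem integral_caputo_kernel_left_eq_right {a x : ℝ} (hx : x ∈ Ioo (-1 : ℝ) 1) :
    ∫ t in Ioo (-1) x, (x - t) ^ (-(2 * a)) * (1 - t ^ 2) ^ (a - 1) =
      ∫ t in Ioo x 1, (t - x) ^ (-(2 * a)) * (1 - t ^ 2) ^ (a - 1) := by
  have hx' : -x ∈ Ioo (-1 : ℝ) 1 := ⟨by linarith [hx.2], by linarith [hx.1]⟩
  have hneg := intervalIntegral.integral_comp_neg (a := x) (b := 1)
    (fun t : ℝ => (-x - t) ^ (-(2 * a)) * (1 - t ^ 2) ^ (a - 1))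
  rw [intervalIntegral.integral_of_le hx.2.le, intervalIntegral.integral_of_le hx'.1.le,
    integral_Ioc_eq_integral_Ioo, integral_Ioc_eq_integral_Ioo,
    integral_caputo_kernel_eq hx', neg_sq, ← integral_caputo_kernel_eq hx] at hneg
  rw [← hneg]
  refine setIntegral_congr_fun measurableSet_Ioo fun t _ => ?_
  simp only [neg_sq]
  congr 2
  ring

/-- For `β ∈ (0,1)`, `h(x) = 2^{1−β}(Γ(β)/Γ(β/2)²) ∫_{−1}^x (1−y²)^{β/2−1} dy`
on `[−1,1]` and `v = 1 − h`: `v(−1) = 1`, `v(1) = 0`, and for every `x ∈ (−1,1)`,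
`(D^β_{−1+*} v)(x) + (D^β_{1−*} v)(x) = 0`. -/
theorem harmonic_function_exit_left
    (β : ℝ) (hβ : β ∈ Set.Ioo (0 : ℝ) 1)
    (h v : ℝ → ℝ)
    (hh : ∀ x : ℝ, h x = (2 : ℝ) ^ (1 - β) * (Real.Gamma β / (Real.Gamma (β / 2)) ^ 2) *
      ∫ y in (-1 : ℝ)..x, (1 - y ^ 2) ^ (β / 2 - 1))
    (hv : ∀ x : ℝ, v x = 1 - h x) :
    v (-1) = 1 ∧ v 1 = 0 ∧
    ∀ x ∈ Set.Ioo (-1 : ℝ) 1, caputoL β (-1) v x + caputoR β 1 v x = 0 := by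
  obtain ⟨hβ0, hβ1⟩ := hβ
  have hI := integral_one_sub_sq_rpow (half_pos hβ0)
  rw [mul_div_cancel₀ β two_ne_zero] at hI
  have hΓ := Real.Gamma_pos_of_pos hβ0
  have hΓ' := Real.Gamma_pos_of_pos (half_pos hβ0)
  have hint : IntervalIntegrable (fun y : ℝ => (1 - y ^ 2) ^ (β / 2 - 1)) volume (-1) 1 :=
    intervalIntegral.intervalIntegrable_of_integral_ne_zero (by rw [hI]; positivity)
  set C : ℝ := (2 : ℝ) ^ (1 - β) * (Real.Gamma β / (Real.Gamma (β / 2)) ^ 2) with hC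
  have hderiv : ∀ t ∈ Ioo (-1 : ℝ) 1, deriv v t = -C * (1 - t ^ 2) ^ (β / 2 - 1) := by
    intro t ht
    have hpos : 1 - t ^ 2 ≠ 0 := by nlinarith [ht.1, ht.2]
    have hmeas : Measurable fun y : ℝ => (1 - y ^ 2) ^ (β / 2 - 1) := by fun_prop
    have hcont : ContinuousAt (fun y : ℝ => (1 - y ^ 2) ^ (β / 2 - 1)) t :=
      ContinuousAt.rpow_const (by fun_prop) (Or.inl hpos)
    have hF := intervalIntegral.integral_hasDerivAt_right
      (hint.mono_set (uIcc_subset_uIcc_left (by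
        rw [uIcc_of_le (by norm_num)]; exact Ioo_subset_Icc_self ht)))
      hmeas.stronglyMeasurable.stronglyMeasurableAtFilter hcont
    have hv' : v = fun x => 1 - C * ∫ y in (-1 : ℝ)..x, (1 - y ^ 2) ^ (β / 2 - 1) := by
      funext x
      rw [hv, hh]
    rw [hv', ((hF.const_mul C).const_sub 1).deriv, neg_mul]
  refine ⟨by simp [hv, hh], ?_, fun x hx => ?_⟩
  · have h4 : (2 : ℝ) ^ (1 - β) * (2 * (4 : ℝ) ^ (β / 2 - 1)) = 1 := by
      rw [show (4 : ℝ) = 2 ^ (2 : ℝ) by norm_num, ← Real.rpow_mul (by norm_num)]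
      nth_rewrite 2 [← Real.rpow_one 2]
      rw [← Real.rpow_add two_pos, ← Real.rpow_add two_pos]
      ring_nf
      exact Real.rpow_zero 2
    rw [hv, hh, hI, hC]
    calc _ = 1 - (2 : ℝ) ^ (1 - β) * (2 * (4 : ℝ) ^ (β / 2 - 1)) := by field_simp
      _ = 0 := by rw [h4, sub_self]
  · have hL : ∫ t in Ioc (-1) x, (x - t) ^ (-β) * deriv v t =
        -C * ∫ t in Ioo (-1) x, (x - t) ^ (-(2 * (β / 2))) * (1 - t ^ 2) ^ (β / 2 - 1) := by
      rw [integral_Ioc_eq_integral_Ioo, ← integral_const_mul]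
      refine setIntegral_congr_fun measurableSet_Ioo fun t ht => ?_
      simp only [hderiv t ⟨ht.1, ht.2.trans hx.2⟩, mul_div_cancel₀ β two_ne_zero]
      ring
    have hR : ∫ t in Ico x 1, (t - x) ^ (-β) * deriv v t =
        -C * ∫ t in Ioo x 1, (t - x) ^ (-(2 * (β / 2))) * (1 - t ^ 2) ^ (β / 2 - 1) := by
      rw [integral_Ico_eq_integral_Ioo, ← integral_const_mul]
      refine setIntegral_congr_fun measurableSet_Ioo fun t ht => ?_
      simp only [hderiv t ⟨hx.1.trans ht.1, ht.2⟩, mul_div_cancel₀ β two_ne_zero]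
      ring
    rw [caputoL, caputoR, hL, hR, integral_caputo_kernel_left_eq_right hx, add_neg_cancel]
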